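/- Let Σ = F⁻¹({0}) be the zero level set of a smooth function F : ℝ³ → ℝ whose gradient is nonvanishing on Σ, let M be the medial axis of Σ and f the local feature size. If q and q' are two points of Σ with dist(q,q') ≤ ε·f(q) for some ε with 0 < ε ≤ 1/3, then the angle between the unit normals satisfies ∠(n_q, n_{q'}) ≤ -ln(1-ε). -/

import Mathlib

open Metric Set

/-- The medial axis of a set `S ⊆ ℝ³`: the closure of the set of points having
more than one nearest point in `S`. -/
noncomputable def medialAxis (S : Set (EuclideanSpace ℝ (Fin 3))) :
    Set (EuclideanSpace ℝ (Fin 3)) :=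
  closure {x | ∃ y ∈ S, ∃ z ∈ S, y ≠ z ∧
    dist x y = Metric.infDist x S ∧ dist x z = Metric.infDist x S}

open scoped Topology RealInnerProductSpace

section SignedDistance

variable {E : Type*} [PseudoMetricSpace E]

/-- The signed distance to the zero set of `F`, with the sign of `F`. -/
noncomputable def signedInfDist (F : E → ℝ) (x : E) : ℝ :=
  Real.sign (F x) * infDist x (F ⁻¹' {0})

theorem signedInfDist_neg (F : E → ℝ) (x : E) :
    signedInfDist (fun y => -F y) x = -signedInfDist F x := by
  have h : (fun y => -F y) ⁻¹' {0} = F ⁻¹' {0} := by ext; simp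
  simp only [signedInfDist, h, Real.sign_neg, neg_mul]

theorem signedInfDist_of_pos {F : E → ℝ} {x : E} (hx : 0 < F x) :
    signedInfDist F x = infDist x (F ⁻¹' {0}) := by
  rw [signedInfDist, Real.sign_of_pos hx, one_mul]

theorem signedInfDist_of_neg {F : E → ℝ} {x : E} (hx : F x < 0) :
    signedInfDist F x = -infDist x (F ⁻¹' {0}) := by
  rw [signedInfDist, Real.sign_of_neg hx, neg_one_mul]

theorem signedInfDist_of_eq_zero {F : E → ℝ} {x : E} (hx : F x = 0) :
    signedInfDist F x = 0 := by
  rw [signedInfDist, hx, Real.sign_zero, zero_mul]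

theorem neg_infDist_le_signedInfDist (F : E → ℝ) (x : E) :
    -infDist x (F ⁻¹' {0}) ≤ signedInfDist F x := by
  have h0 : 0 ≤ infDist x (F ⁻¹' {0}) := infDist_nonneg
  rcases lt_trichotomy (F x) 0 with h | h | h
  · rw [signedInfDist_of_neg h]
  · rw [signedInfDist_of_eq_zero h]; linarith
  · rw [signedInfDist_of_pos h]; linarith

end SignedDistance

section InnerProduct

variable {E : Type*} [NormedAddCommGroup E] [InnerProductSpace ℝ E]

/-- On a segment joining points where `F` has opposite weak signs there is a zero of `F`. -/
theorem infDist_add_infDist_le_dist {F : E → ℝ} (hF : Continuous F) {x y : E}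
    (hx : 0 ≤ F x) (hy : F y ≤ 0) :
    infDist x (F ⁻¹' {0}) + infDist y (F ⁻¹' {0}) ≤ dist x y := by
  obtain ⟨z, hz, hz0⟩ : ∃ z ∈ segment ℝ x y, F z = 0 :=
    (convex_segment x y).isPreconnected.intermediate_value (right_mem_segment ℝ x y)
      (left_mem_segment ℝ x y) hF.continuousOn ⟨hy, hx⟩
  have h1 : infDist x (F ⁻¹' {0}) ≤ dist x z := infDist_le_dist_of_mem hz0
  have h2 : infDist y (F ⁻¹' {0}) ≤ dist y z := infDist_le_dist_of_mem hz0
  have h3 := dist_add_dist_of_mem_segment hz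
  rw [dist_comm y z] at h2
  linarith

theorem signedInfDist_sub_le_dist {F : E → ℝ} (hF : Continuous F) (x y : E) :
    signedInfDist F x - signedInfDist F y ≤ dist x y := by
  have hx0 : 0 ≤ infDist x (F ⁻¹' {0}) := infDist_nonneg
  have hy0 : 0 ≤ infDist y (F ⁻¹' {0}) := infDist_nonneg
  have hxy : infDist x (F ⁻¹' {0}) ≤ infDist y (F ⁻¹' {0}) + dist x y :=
    infDist_le_infDist_add_dist
  have hyx : infDist y (F ⁻¹' {0}) ≤ infDist x (F ⁻¹' {0}) + dist y x :=
    infDist_le_infDist_add_dist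
  rw [dist_comm y x] at hyx
  rcases le_or_gt (F y) 0 with hy | hy
  · have hy' := neg_infDist_le_signedInfDist F y
    rcases lt_or_ge (F x) 0 with hx | hx
    · rw [signedInfDist_of_neg hx]
      linarith
    · have := infDist_add_infDist_le_dist hF hx hy
      rcases hx.eq_or_lt with hx | hx
      · rw [signedInfDist_of_eq_zero hx.symm]; linarith
      · rw [signedInfDist_of_pos hx]; linarith
  · rw [signedInfDist_of_pos hy]
    rcases lt_trichotomy (F x) 0 with hx | hx | hx
    · rw [signedInfDist_of_neg hx]; linarith [dist_nonneg (x := x) (y := y)]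
    · rw [signedInfDist_of_eq_zero hx]; linarith [dist_nonneg (x := x) (y := y)]
    · rw [signedInfDist_of_pos hx]; linarith

/-- `w` is a unit vector along which `h` grows at `y` with one-sided lower slope at least `1`. -/
def IsUnitSlopeDirection (h : E → ℝ) (y w : E) : Prop :=
  ‖w‖ = 1 ∧ ∀ c, 0 ≤ c → c < 1 → ∀ᶠ t in 𝓝[>] (0 : ℝ), h y + c * t < h (y + t • w)

/-- At a regular zero of `F` the signed distance grows at unit rate along the gradient. -/
theorem isUnitSlopeDirection_gradient [ProperSpace E] {F : E → ℝ} (hF : Continuous F) {y g : E}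
    (hy : F y = 0) (hg : HasGradientAt F g y) (hg0 : g ≠ 0) :
    IsUnitSlopeDirection (signedInfDist F) y (‖g‖⁻¹ • g) := by
  have hgpos : 0 < ‖g‖ := norm_pos_iff.2 hg0
  refine ⟨norm_smul_inv_norm hg0, fun c hc0 hc => ?_⟩
  set n : E := ‖g‖⁻¹ • g with hn
  have hn1 : ‖n‖ = 1 := norm_smul_inv_norm hg0
  have hgn : g = ‖g‖ • n := by rw [hn, smul_inv_smul₀ hgpos.ne']
  clear_value n
  obtain ⟨η, hη⟩ : ∃ η : ℝ, c = 1 - 4 * η := ⟨(1 - c) / 4, by ring⟩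
  have hη0 : 0 < η := by linarith
  obtain ⟨δ, hδ, hball⟩ := Metric.eventually_nhds_iff.1
    ((hasGradientAt_iff_isLittleO.1 hg).bound (mul_pos hη0 hgpos))
  have hclosed : IsClosed (F ⁻¹' {0}) := isClosed_singleton.preimage hF
  filter_upwards [Ioo_mem_nhdsGT (half_pos hδ)] with t ht
  have ht0 : 0 < t := ht.1
  have ht2 : 2 * t < δ := by linarith [ht.2]
  have hdt : dist (y + t • n) y = t := by
    rw [dist_eq_norm, add_sub_cancel_left, norm_smul, hn1, mul_one, Real.norm_of_nonneg ht0.le]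
  have hpos : 0 < F (y + t • n) := by
    have h1 := hball (y := y + t • n) (by rw [hdt]; linarith)
    rw [← dist_eq_norm (y + t • n) y, hdt, hy, add_sub_cancel_left, sub_zero, hgn,
      real_inner_smul_left, real_inner_smul_right, real_inner_self_eq_norm_sq, hn1, norm_smul,
      hn1, Real.norm_eq_abs] at h1
    have h2 := (abs_le.1 h1).1
    rw [Real.norm_eq_abs, abs_of_pos hgpos] at h2
    have h3 : 0 < ‖g‖ * t := mul_pos hgpos ht0
    nlinarith
  rw [signedInfDist_of_pos hpos, signedInfDist_of_eq_zero hy, zero_add]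
  obtain ⟨z, hz, hzd⟩ := hclosed.exists_infDist_eq_dist ⟨y, hy⟩ (y + t • n)
  have hle : infDist (y + t • n) (F ⁻¹' {0}) ≤ t := by
    simpa only [hdt] using infDist_le_dist_of_mem (x := y + t • n) (s := F ⁻¹' {0}) (y := y) hy
  have hzy : dist z y ≤ 2 * t := by
    have := dist_triangle_left z y (y + t • n)
    rw [← hzd, hdt] at this
    linarith
  have h1 := hball (y := z) (by linarith)
  rw [show F z = 0 from hz, hy, sub_zero, zero_sub, norm_neg, ← dist_eq_norm, hgn,
    real_inner_smul_left, norm_mul, norm_norm, norm_smul, norm_norm, hn1, mul_one] at h1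
  have h2 : |⟪n, z - y⟫| ≤ η * dist z y := by
    rw [Real.norm_eq_abs] at h1
    refine le_of_mul_le_mul_left (h1.trans_eq ?_) hgpos
    ring
  have h3 : ⟪n, y + t • n - z⟫ = t - ⟪n, z - y⟫ := by
    rw [show y + t • n - z = t • n - (z - y) by abel, inner_sub_right, real_inner_smul_right,
      real_inner_self_eq_norm_sq, hn1]
    ring
  have h4 : ⟪n, y + t • n - z⟫ ≤ dist (y + t • n) z := by
    simpa only [hn1, one_mul, dist_eq_norm] using real_inner_le_norm n (y + t • n - z)
  have h5 := (abs_le.1 h2).2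
  rw [hzd]
  nlinarith

/-- Away from the zero set, on the positive side, the signed distance grows at unit rate away
from a unique nearest point. -/
theorem exists_isUnitSlopeDirection_of_pos [ProperSpace E] {F : E → ℝ} (hF : Continuous F)
    (hne : (F ⁻¹' {0}).Nonempty) {y : E} (hy : 0 < F y)
    (huniq : {p | p ∈ F ⁻¹' {0} ∧ dist y p = infDist y (F ⁻¹' {0})}.Subsingleton) :
    ∃ w, IsUnitSlopeDirection (signedInfDist F) y w := by
  have hclosed : IsClosed (F ⁻¹' {0}) := isClosed_singleton.preimage hF
  obtain ⟨p, hp, hpd⟩ := hclosed.exists_infDist_eq_dist hne y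
  set d := infDist y (F ⁻¹' {0}) with hd
  have hd0 : 0 < d := by
    rw [hd, ← hclosed.notMem_iff_infDist_pos hne]
    exact hy.ne'
  have hyp : ‖y - p‖ = d := by rw [← dist_eq_norm, hpd]
  set w : E := d⁻¹ • (y - p) with hw
  have hw1 : ‖w‖ = 1 := by
    rw [hw, norm_smul, hyp, norm_inv, Real.norm_of_nonneg hd0.le, inv_mul_cancel₀ hd0.ne']
  refine ⟨w, hw1, fun c hc0 hc => ?_⟩
  have hwp : ⟪w, y - p⟫ = d := by
    rw [hw, real_inner_smul_left, real_inner_self_eq_norm_sq, hyp]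
    field_simp
  clear_value w
  set K : Set E := F ⁻¹' {0} ∩ {z | ⟪w, y - z⟫ ≤ c * d} with hK
  have hKclosed : IsClosed K := hclosed.inter (isClosed_le (by fun_prop) continuous_const)
  obtain ⟨γ, hγ, hgap⟩ : ∃ γ > 0, ∀ z ∈ K, d + γ ≤ dist y z := by
    rcases K.eq_empty_or_nonempty with hKe | hKne
    · exact ⟨1, one_pos, by simp [hKe]⟩
    · obtain ⟨k, hk, hkd⟩ := hKclosed.exists_infDist_eq_dist hKne y
      have hdk : d ≤ dist y k := infDist_le_dist_of_mem hk.1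
      have hne' : d ≠ dist y k := fun h => by
        have hkp : k = p := huniq ⟨hk.1, h.symm⟩ ⟨hp, hpd.symm⟩
        have := hk.2
        rw [mem_ofPred_eq, hkp, hwp] at this
        nlinarith
      refine ⟨dist y k - d, sub_pos.2 (lt_of_le_of_ne hdk hne'), fun z hz => ?_⟩
      rw [add_sub_cancel, ← hkd]
      exact infDist_le_dist_of_mem hz
  have hFpos : ∀ᶠ t in 𝓝[>] (0 : ℝ), 0 < F (y + t • w) := by
    have hcont : Continuous fun t : ℝ => F (y + t • w) := by fun_prop
    refine nhdsWithin_le_nhds (hcont.continuousAt.eventually (lt_mem_nhds ?_))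
    simpa using hy
  filter_upwards [hFpos, Ioo_mem_nhdsGT (half_pos hγ)] with t htF ht
  have ht0 : 0 < t := ht.1
  have ht2 : 2 * t < γ := by linarith [ht.2]
  rw [signedInfDist_of_pos hy, signedInfDist_of_pos htF, ← hd]
  obtain ⟨z, hz, hzd⟩ := hclosed.exists_infDist_eq_dist hne (y + t • w)
  have hdt : dist (y + t • w) y = t := by
    rw [dist_eq_norm, add_sub_cancel_left, norm_smul, hw1, mul_one, Real.norm_of_nonneg ht0.le]
  have hle : infDist (y + t • w) (F ⁻¹' {0}) ≤ d + t := by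
    simpa only [hdt] using infDist_le_infDist_add_dist (x := y + t • w) (y := y) (s := F ⁻¹' {0})
  have hzK : z ∉ K := fun hzK => by
    have h1 := hgap z hzK
    have h2 := dist_triangle_left y z (y + t • w)
    rw [hdt, ← hzd] at h2
    linarith
  have hin : c * d < ⟪w, y - z⟫ := by
    by_contra hcon
    exact hzK ⟨hz, not_lt.1 hcon⟩
  have hdz : d ≤ ‖y - z‖ := by
    rw [← dist_eq_norm]
    exact infDist_le_dist_of_mem hz
  have hsq : dist (y + t • w) z ^ 2 = ‖y - z‖ ^ 2 + 2 * t * ⟪w, y - z⟫ + t ^ 2 := by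
    rw [dist_eq_norm, show y + t • w - z = (y - z) + t • w by abel, norm_add_sq_real,
      real_inner_smul_right, norm_smul, hw1, real_inner_comm, mul_one, Real.norm_eq_abs, sq_abs]
    ring
  rw [hzd]
  refine lt_of_pow_lt_pow_left₀ 2 dist_nonneg ?_
  have hsq_d : d ^ 2 ≤ ‖y - z‖ ^ 2 := pow_le_pow_left₀ hd0.le hdz 2
  have hsq_c : c ^ 2 * t ^ 2 < t ^ 2 := by
    nlinarith [pow_pos ht0 2, pow_lt_one₀ hc0 hc two_ne_zero]
  have hin_t : t * (c * d) < t * ⟪w, y - z⟫ := mul_lt_mul_of_pos_left hin ht0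
  rw [hsq]
  linear_combination hsq_d + hsq_c + 2 * hin_t

/-- Away from the zero set, on the negative side, the signed distance grows at unit rate towards
any nearest point. -/
theorem exists_isUnitSlopeDirection_of_neg [ProperSpace E] {F : E → ℝ} (hF : Continuous F)
    (hne : (F ⁻¹' {0}).Nonempty) {y : E} (hy : F y < 0) :
    ∃ w, IsUnitSlopeDirection (signedInfDist F) y w := by
  have hclosed : IsClosed (F ⁻¹' {0}) := isClosed_singleton.preimage hF
  obtain ⟨p, hp, hpd⟩ := hclosed.exists_infDist_eq_dist hne y
  set d := infDist y (F ⁻¹' {0}) with hd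
  have hd0 : 0 < d := by
    rw [hd, ← hclosed.notMem_iff_infDist_pos hne]
    exact hy.ne
  have hyp : ‖p - y‖ = d := by rw [← dist_eq_norm, dist_comm, hpd]
  refine ⟨d⁻¹ • (p - y), ?_, fun c hc0 hc => ?_⟩
  · rw [norm_smul, hyp, norm_inv, Real.norm_of_nonneg hd0.le, inv_mul_cancel₀ hd0.ne']
  filter_upwards [Ioo_mem_nhdsGT hd0] with t ht
  have h1 : infDist (y + t • d⁻¹ • (p - y)) (F ⁻¹' {0}) ≤ d - t := by
    refine (infDist_le_dist_of_mem hp).trans_eq ?_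
    rw [dist_eq_norm, show y + t • d⁻¹ • (p - y) - p = (t * d⁻¹ - 1) • (p - y) by
      rw [sub_smul, mul_smul, one_smul]; abel, norm_smul, hyp, Real.norm_eq_abs, abs_sub_comm,
      abs_of_nonneg]
    · field_simp
    · rw [sub_nonneg, ← div_eq_mul_inv]
      exact (div_le_one hd0).2 ht.2.le
  have h2 := neg_infDist_le_signedInfDist F (y + t • d⁻¹ • (p - y))
  rw [signedInfDist_of_neg hy, ← hd]
  nlinarith [ht.1]

/-- The signed distance to a regular zero set has a unit-slope direction at every point with a
unique nearest zero. -/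
theorem exists_isUnitSlopeDirection [ProperSpace E] {F : E → ℝ} (hF : Continuous F)
    (hreg : ∀ p, F p = 0 → ∃ g, g ≠ 0 ∧ HasGradientAt F g p) (hne : (F ⁻¹' {0}).Nonempty) {y : E}
    (huniq : {p | p ∈ F ⁻¹' {0} ∧ dist y p = infDist y (F ⁻¹' {0})}.Subsingleton) :
    ∃ w, IsUnitSlopeDirection (signedInfDist F) y w := by
  rcases lt_trichotomy (F y) 0 with hy | hy | hy
  · exact exists_isUnitSlopeDirection_of_neg hF hne hy
  · obtain ⟨g, hg0, hg⟩ := hreg y hy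
    exact ⟨_, isUnitSlopeDirection_gradient hF hy hg hg0⟩
  · exact exists_isUnitSlopeDirection_of_pos hF hne hy huniq

/-- A function with unit upward slopes throughout a ball rises by the radius inside it. -/
theorem exists_mem_closedBall_add_le [ProperSpace E] {h : E → ℝ} (hh : Continuous h) {x : E}
    {r : ℝ} (hr : 0 ≤ r) (hslope : ∀ y ∈ ball x r, ∃ w, IsUnitSlopeDirection h y w) :
    ∃ y ∈ closedBall x r, h x + r ≤ h y := by
  have hne : (closedBall x r).Nonempty := ⟨x, mem_closedBall_self hr⟩
  obtain ⟨y, hy, hmax⟩ := (isCompact_closedBall x r).exists_isMaxOn hne hh.continuousOn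
  refine ⟨y, hy, le_of_forall_pos_lt_add fun δ hδ => ?_⟩
  obtain ⟨c, hc0, hc1, hcr⟩ : ∃ c : ℝ, 0 ≤ c ∧ c < 1 ∧ r < c * r + δ := by
    refine ⟨1 - δ / (r + δ), ?_, ?_, ?_⟩
    · rw [sub_nonneg, div_le_one (by linarith)]; linarith
    · have : 0 < δ / (r + δ) := by positivity
      linarith
    · have : δ / (r + δ) * r < δ := by
        rw [div_mul_eq_mul_div, div_lt_iff₀ (by linarith)]; nlinarith
      linarith
  obtain ⟨z, hz, hzmax⟩ := (isCompact_closedBall x r).exists_isMaxOn hne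
    (f := fun z => h z - c * dist z x) (by fun_prop)
  have hxz := hzmax (mem_closedBall_self hr)
  simp only [mem_ofPred_eq, dist_self, mul_zero, sub_zero] at hxz
  have hzr : dist z x = r := by
    by_contra hcon
    have hzb : z ∈ ball x r := lt_of_le_of_ne hz hcon
    obtain ⟨w, hw1, hw⟩ := hslope z hzb
    have hin : ∀ᶠ t in 𝓝[>] (0 : ℝ), z + t • w ∈ ball x r := by
      have hcont : Continuous fun t : ℝ => z + t • w := by fun_prop
      refine nhdsWithin_le_nhds (hcont.continuousAt.eventually (isOpen_ball.mem_nhds ?_))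
      simpa using hzb
    obtain ⟨t, ht, htb, ht0⟩ := ((hw c hc0 hc1).and (hin.and self_mem_nhdsWithin)).exists
    have ht0 : 0 < t := ht0
    have h1 := hzmax (ball_subset_closedBall htb)
    simp only [mem_ofPred_eq] at h1
    have h2 : dist (z + t • w) x ≤ t + dist z x := by
      refine (dist_triangle _ z x).trans_eq ?_
      rw [dist_eq_norm (z + t • w), add_sub_cancel_left, norm_smul, hw1, mul_one,
        Real.norm_of_nonneg ht0.le]
    nlinarith
  have hzy : h z ≤ h y := hmax hz
  rw [hzr] at hxz
  linarith

/-- Two points at distance at most `r` from `x` and at least `2 * r` from each other are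
antipodal with respect to `x`. -/
theorem sub_eq_neg_sub_of_two_mul_le_dist {x y z : E} {r : ℝ} (hy : dist y x ≤ r)
    (hz : dist z x ≤ r) (hyz : 2 * r ≤ dist y z) : z - x = -(y - x) := by
  have hpar := parallelogram_law_with_norm ℝ (y - x) (z - x)
  rw [dist_eq_norm] at hy hz hyz
  rw [sub_sub_sub_cancel_right] at hpar
  have h0 : 0 ≤ r := (norm_nonneg _).trans hy
  have h1 : ‖y - x + (z - x)‖ * ‖y - x + (z - x)‖ ≤ 0 := by
    nlinarith [norm_nonneg (y - x), norm_nonneg (z - x), norm_nonneg (y - z)]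
  have h2 : ‖y - x + (z - x)‖ = 0 := by nlinarith [norm_nonneg (y - x + (z - x))]
  exact eq_neg_of_add_eq_zero_right (norm_eq_zero.1 h2)

/-- `h` grows at exact unit rate along the segment of half-length `r` centred at `x` with
direction `w`. -/
def IsUnitSpeedSegment (h : E → ℝ) (x w : E) (r : ℝ) : Prop :=
  ‖w‖ = 1 ∧ ∀ ρ, |ρ| ≤ r → h (x + ρ • w) = h x + ρ

theorem IsUnitSpeedSegment.mono {h : E → ℝ} {x w : E} {r s : ℝ}
    (hw : IsUnitSpeedSegment h x w s) (hrs : r ≤ s) : IsUnitSpeedSegment h x w r :=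
  ⟨hw.1, fun ρ hρ => hw.2 ρ (hρ.trans hrs)⟩

theorem exists_isUnitSpeedSegment [ProperSpace E] {h : E → ℝ}
    (hh : ∀ x y, h x - h y ≤ dist x y) {x : E} {r : ℝ} (hr : 0 < r)
    (hup : ∀ y ∈ ball x r, ∃ w, IsUnitSlopeDirection h y w)
    (hdown : ∀ y ∈ ball x r, ∃ w, IsUnitSlopeDirection (fun z => -h z) y w) :
    ∃ w, IsUnitSpeedSegment h x w r := by
  have hcont : Continuous h :=
    (LipschitzWith.of_le_add fun x y => by linarith [hh x y]).continuous
  obtain ⟨y, hy, hxy⟩ := exists_mem_closedBall_add_le hcont hr.le hup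
  obtain ⟨z, hz, hxz⟩ := exists_mem_closedBall_add_le hcont.neg hr.le hdown
  rw [Pi.neg_apply, Pi.neg_apply] at hxz
  have hanti := sub_eq_neg_sub_of_two_mul_le_dist hy hz (by linarith [hh y z])
  have hyr : ‖y - x‖ = r := by
    rw [← dist_eq_norm]
    exact le_antisymm hy (by linarith [hh y x])
  have hw1 : ‖r⁻¹ • (y - x)‖ = 1 := by
    rw [norm_smul, hyr, norm_inv, Real.norm_of_nonneg hr.le, inv_mul_cancel₀ hr.ne']
  have hyw : y = x + r • r⁻¹ • (y - x) := by rw [smul_inv_smul₀ hr.ne']; abel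
  have hzw : z = x + (-r) • r⁻¹ • (y - x) := by
    rw [neg_smul, smul_inv_smul₀ hr.ne', ← hanti]; abel
  refine ⟨r⁻¹ • (y - x), hw1, fun ρ hρ => ?_⟩
  set w := r⁻¹ • (y - x)
  have hdist : ∀ a b : ℝ, dist (x + a • w) (x + b • w) = |a - b| := fun a b => by
    rw [dist_eq_norm, add_sub_add_left_eq_sub, ← sub_smul, norm_smul, hw1, mul_one,
      Real.norm_eq_abs]
  obtain ⟨h1, h2⟩ := abs_le.1 hρ
  have h3 := hh y (x + ρ • w)
  have h4 := hh (x + ρ • w) z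
  rw [hyw, hdist, ← hyw, abs_of_nonneg (by linarith)] at h3
  rw [hzw, hdist, ← hzw, abs_of_nonneg (by linarith)] at h4
  linarith

/-- The signed distance to a regular zero set has a unit-speed segment centred at `x`, as long as
all points of the corresponding ball have a unique nearest zero. -/
theorem exists_isUnitSpeedSegment_signedInfDist [ProperSpace E] {F : E → ℝ} (hF : Continuous F)
    (hreg : ∀ p, F p = 0 → ∃ g, g ≠ 0 ∧ HasGradientAt F g p) (hne : (F ⁻¹' {0}).Nonempty) {x : E}
    {r : ℝ} (hr : 0 < r) (huniq : ∀ y ∈ ball x r,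
      {p | p ∈ F ⁻¹' {0} ∧ dist y p = infDist y (F ⁻¹' {0})}.Subsingleton) :
    ∃ w, IsUnitSpeedSegment (signedInfDist F) x w r := by
  refine exists_isUnitSpeedSegment (signedInfDist_sub_le_dist hF) hr
    (fun y hy => exists_isUnitSlopeDirection hF hreg hne (huniq y hy)) fun y hy => ?_
  have hset : (fun y => -F y) ⁻¹' {0} = F ⁻¹' {0} := by ext; simp
  have hregneg : ∀ p, -F p = 0 → ∃ g, g ≠ 0 ∧ HasGradientAt (fun y => -F y) g p := fun p hp => by
    obtain ⟨g, hg0, hg⟩ := hreg p (neg_eq_zero.1 hp)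
    refine ⟨-g, neg_ne_zero.2 hg0, ?_⟩
    rw [hasGradientAt_iff_hasFDerivAt, map_neg]
    exact hg.hasFDerivAt.neg
  obtain ⟨w, hw⟩ := exists_isUnitSlopeDirection (F := fun y => -F y) hF.neg hregneg
    (by rwa [hset]) (y := y) (by rw [hset]; exact huniq y hy)
  exact ⟨w, by simpa only [funext (signedInfDist_neg F)] using hw⟩

/-- Directions of unit-speed segments of a `1`-Lipschitz function vary at a rate at most the
inverse of their half-length. -/
theorem IsUnitSpeedSegment.mul_norm_sub_le {h : E → ℝ} (hh : ∀ x y, h x - h y ≤ dist x y)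
    {x y v w : E} {r : ℝ} (hr : 0 ≤ r) (hv : IsUnitSpeedSegment h x v r)
    (hw : IsUnitSpeedSegment h y w r) : r * ‖v - w‖ ≤ dist x y := by
  have hrr : |r| ≤ r := (abs_of_nonneg hr).le
  have hrn : |-r| ≤ r := (abs_neg r).trans_le hrr
  have hvw := parallelogram_law_with_norm ℝ v w
  rw [hv.1, hw.1] at hvw
  rcases le_total (2 * r) (dist x y) with hfar | hnear
  · have := norm_sub_le v w
    rw [hv.1, hw.1] at this
    nlinarith
  have key : ∀ {x y v w : E}, IsUnitSpeedSegment h x v r → IsUnitSpeedSegment h y w r →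
      dist x y ≤ 2 * r → (2 * r + (h x - h y)) ^ 2 ≤
        dist x y ^ 2 + 2 * r * ⟪x - y, v + w⟫ + r ^ 2 * ‖v + w‖ ^ 2 := by
    intro x y v w hv hw hxy
    have h1 := hh (x + r • v) (y + (-r) • w)
    rw [hv.2 r hrr, hw.2 (-r) hrn, dist_eq_norm,
      show x + r • v - (y + (-r) • w) = x - y + r • (v + w) by
        rw [neg_smul, smul_add]; abel] at h1
    have h2 := hh y x
    rw [dist_comm] at h2
    refine (pow_le_pow_left₀ (by linarith)
      (show 2 * r + (h x - h y) ≤ ‖x - y + r • (v + w)‖ by linarith) 2).trans_eq ?_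
    rw [norm_add_sq_real, real_inner_smul_right, norm_smul, Real.norm_eq_abs, mul_pow, sq_abs,
      dist_eq_norm]
    ring
  have h1 := key hv hw hnear
  have h2 := key hw hv (by rwa [dist_comm])
  rw [dist_comm y x, add_comm w v, ← neg_sub x y, inner_neg_left] at h2
  refine (sq_le_sq₀ (by positivity) dist_nonneg).1 ?_
  nlinarith [sq_nonneg (h x - h y)]

theorem IsUnitSpeedSegment.eq_of_isUnitSlopeDirection {h : E → ℝ}
    (hh : ∀ x y, h x - h y ≤ dist x y) {x v w : E} {r : ℝ} (hr : 0 < r)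
    (hw : IsUnitSpeedSegment h x w r) (hv : IsUnitSlopeDirection h x v) : w = v := by
  have h2 : 2 ≤ ‖v + w‖ := by
    refine le_of_forall_pos_lt_add fun δ hδ => ?_
    have hc1 : 1 - min δ 1 < 1 := by simp [hδ]
    obtain ⟨t, ht, ht0, htr⟩ := ((hv.2 (1 - min δ 1) (by simp) hc1).and
      (Ioo_mem_nhdsGT hr)).exists
    have h1 := hh (x + t • v) (x + (-t) • w)
    rw [hw.2 (-t) (by rw [abs_neg, abs_of_pos ht0]; exact htr.le), dist_eq_norm,
      show x + t • v - (x + (-t) • w) = t • (v + w) by rw [neg_smul, smul_add]; abel,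
      norm_smul, Real.norm_of_nonneg ht0.le] at h1
    have h3 : t * (2 - min δ 1) < t * ‖v + w‖ := by linarith
    linarith [lt_of_mul_lt_mul_left h3 ht0.le, min_le_left δ 1]
  have hpar := parallelogram_law_with_norm ℝ v w
  rw [hv.1, hw.1] at hpar
  have h0 : ‖v - w‖ = 0 := by nlinarith [norm_nonneg (v - w)]
  exact (sub_eq_zero.1 (norm_eq_zero.1 h0)).symm

theorem angle_le_norm_sub_add_cube {u v : E} (hu : ‖u‖ = 1) (hv : ‖v‖ = 1) :
    InnerProductGeometry.angle u v ≤ ‖u - v‖ + ‖u - v‖ ^ 3 := by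
  set θ := InnerProductGeometry.angle u v with hθ
  have hθ0 : 0 ≤ θ := InnerProductGeometry.angle_nonneg u v
  have hθpi : θ ≤ Real.pi := InnerProductGeometry.angle_le_pi u v
  have hchord : ‖u - v‖ = 2 * Real.sin (θ / 2) := by
    have hsin : 0 ≤ Real.sin (θ / 2) :=
      Real.sin_nonneg_of_nonneg_of_le_pi (by linarith) (by linarith)
    refine (sq_eq_sq₀ (norm_nonneg _) (by linarith)).1 ?_
    have hcos : ⟪u, v⟫ = Real.cos θ := by
      rw [hθ, InnerProductGeometry.cos_angle, hu, hv, mul_one, div_one]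
    rw [norm_sub_sq_real, hu, hv, hcos, mul_pow, Real.sin_sq_eq_half_sub,
      mul_div_cancel₀ θ two_ne_zero]
    ring
  rcases hθ0.eq_or_lt with h0 | hpos
  · rw [← h0]; positivity
  have hcube := Real.sin_gt_sub_cube (half_pos hpos)
  have hlin := Real.mul_le_sin (half_pos hpos).le (by linarith)
  have hle : θ ≤ 2 * ‖u - v‖ := by
    have : 1 / 2 ≤ 2 / Real.pi := by
      rw [div_le_div_iff₀ two_pos Real.pi_pos]; linarith [Real.pi_le_four]
    nlinarith
  have h3 : θ ^ 3 ≤ (2 * ‖u - v‖) ^ 3 := pow_le_pow_left₀ hθ0 hle 3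
  have h4 : 0 ≤ ‖u - v‖ ^ 3 := by positivity
  have h5 : θ - θ ^ 3 / 24 ≤ ‖u - v‖ := by rw [hchord]; linear_combination 2 * hcube
  linear_combination h5 + h3 / 24 + 2 / 3 * h4

/-- A curve of unit vectors with speed at most `ε / (1 - ε * t)` on `[0, 1]` turns by at most
`-log (1 - ε)`. -/
theorem angle_le_neg_log_of_norm_sub_le {ε : ℝ} (hε0 : 0 ≤ ε) (hε1 : ε < 1) {w : ℝ → E}
    (hw : ∀ t ∈ Icc (0 : ℝ) 1, ‖w t‖ = 1)
    (hspeed : ∀ s ∈ Icc (0 : ℝ) 1, ∀ t ∈ Icc (0 : ℝ) 1, s ≤ t →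
      ‖w s - w t‖ ≤ ε / (1 - ε * t) * (t - s)) :
    InnerProductGeometry.angle (w 0) (w 1) ≤ -Real.log (1 - ε) := by
  have hpos : ∀ t ∈ Icc (0 : ℝ) 1, 0 < 1 - ε * t := fun t ht => by nlinarith [ht.1, ht.2]
  have hw0 : ∀ t ∈ Icc (0 : ℝ) 1, w t ≠ 0 := fun t ht => by
    rw [← norm_ne_zero_iff, hw t ht]; exact one_ne_zero
  have hlip : ∀ s ∈ Icc (0 : ℝ) 1, ∀ t ∈ Icc (0 : ℝ) 1, s ≤ t →
      dist (w s) (w t) ≤ ε / (1 - ε) * dist s t := fun s hs t ht hst => by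
    rw [dist_eq_norm, dist_comm, Real.dist_eq, abs_of_nonneg (sub_nonneg.2 hst)]
    refine (hspeed s hs t ht hst).trans (mul_le_mul_of_nonneg_right ?_ (sub_nonneg.2 hst))
    exact div_le_div_of_nonneg_left hε0 (by linarith) (by nlinarith [ht.2])
  have hwcont : ContinuousOn w (Icc 0 1) := by
    refine LipschitzOnWith.continuousOn (K := (ε / (1 - ε)).toNNReal)
      (LipschitzOnWith.of_dist_le_mul fun s hs t ht => ?_)
    rw [Real.coe_toNNReal _ (div_nonneg hε0 (by linarith))]
    rcases le_total s t with hst | hst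
    · exact hlip s hs t ht hst
    · rw [dist_comm, dist_comm s]
      exact hlip t ht s hs hst
  have h0mem : (0 : ℝ) ∈ Icc (0 : ℝ) 1 := left_mem_Icc.2 zero_le_one
  have h1mem : (1 : ℝ) ∈ Icc (0 : ℝ) 1 := right_mem_Icc.2 zero_le_one
  have hangle : ContinuousOn (fun t => InnerProductGeometry.angle (w 0) (w t)) (Icc 0 1) :=
    fun t ht => ContinuousAt.comp_continuousWithinAt (f := fun t => (w 0, w t))
      (InnerProductGeometry.continuousAt_angle (x := (w 0, w t)) (hw0 0 h0mem) (hw0 t ht))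
      (continuousWithinAt_const.prodMk (hwcont t ht))
  have hderiv : ∀ t ∈ Icc (0 : ℝ) 1,
      HasDerivAt (fun t => -Real.log (1 - ε * t)) (ε / (1 - ε * t)) t := fun t ht => by
    have h1 : HasDerivAt (fun t => 1 - ε * t) (-ε) t := by
      simpa using ((hasDerivAt_id t).const_mul ε).const_sub 1
    simpa [neg_div] using (h1.log (hpos t ht).ne').fun_neg
  have hmain := image_le_of_liminf_slope_right_le_deriv_boundary
    (f := fun t => InnerProductGeometry.angle (w 0) (w t)) (a := 0) (b := 1)
    (B := fun t => -Real.log (1 - ε * t)) (B' := fun t => ε / (1 - ε * t))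
    hangle
    (by simp [InnerProductGeometry.angle_self (hw0 0 h0mem)])
    (fun t ht => (hderiv t ht).continuousAt.continuousWithinAt)
    (fun t ht => (hderiv t (Ico_subset_Icc_self ht)).hasDerivWithinAt)
    (fun t ht r hr => ?_) h1mem
  · simpa using hmain
  have htmem := Ico_subset_Icc_self ht
  have hbound : ∀ᶠ z in 𝓝[>] t,
      ε / (1 - ε * z) + (ε / (1 - ε * z)) ^ 3 * (z - t) ^ 2 < r := by
    have hdiv : ContinuousAt (fun z => ε / (1 - ε * z)) t :=
      continuousAt_const.div (by fun_prop) (hpos t htmem).ne'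
    have hcont : ContinuousAt
        (fun z => ε / (1 - ε * z) + (ε / (1 - ε * z)) ^ 3 * (z - t) ^ 2) t :=
      hdiv.add ((hdiv.pow 3).mul (by fun_prop))
    exact nhdsWithin_le_nhds (hcont.eventually (gt_mem_nhds (by simpa using hr)))
  refine Filter.Eventually.frequently ?_
  filter_upwards [hbound, Ioo_mem_nhdsGT ht.2] with z hz hzt
  have hzmem : z ∈ Icc (0 : ℝ) 1 := ⟨ht.1.trans hzt.1.le, hzt.2.le⟩
  have hzt0 : 0 < z - t := sub_pos.2 hzt.1
  rw [slope_def_field, div_lt_iff₀ hzt0]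
  have h1 := InnerProductGeometry.angle_le_angle_add_angle (w 0) (w t) (w z)
  have h2 := angle_le_norm_sub_add_cube (hw t htmem) (hw z hzmem)
  have h3 := hspeed t htmem z hzmem hzt.1.le
  have h4 := pow_le_pow_left₀ (norm_nonneg _) h3 3
  have h5 := mul_lt_mul_of_pos_right hz hzt0
  linear_combination h1 + h2 + h3 + h4 + h5

end InnerProduct

/-- Normal variation theorem: if `q, q' ∈ Σ` with `dist q q' ≤ ε · f q`,
`0 < ε ≤ 1/3`, then the angle between the unit normals is at most `-ln(1-ε)`. -/
theorem normal_variation_log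
    (F : EuclideanSpace ℝ (Fin 3) → ℝ) (hF : ContDiff ℝ (⊤ : ℕ∞) F)
    (S : Set (EuclideanSpace ℝ (Fin 3))) (hS : S = F ⁻¹' {0})
    (hScomp : IsCompact S)
    (hgrad : ∀ p ∈ S, gradient F p ≠ 0)
    (M : Set (EuclideanSpace ℝ (Fin 3))) (hM : M = medialAxis S)
    (hMne : M.Nonempty)
    (f : EuclideanSpace ℝ (Fin 3) → ℝ) (hf : ∀ x, f x = Metric.infDist x M)
    (q q' : EuclideanSpace ℝ (Fin 3)) (hq : q ∈ S) (hq' : q' ∈ S)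
    (ε : ℝ) (hε0 : 0 < ε) (hε : ε ≤ 1/3)
    (hd : dist q q' ≤ ε * f q) :
    InnerProductGeometry.angle
      ((‖gradient F q‖)⁻¹ • gradient F q)
      ((‖gradient F q'‖)⁻¹ • gradient F q') ≤ -Real.log (1 - ε) := by
  subst hS
  have hFc : Continuous F := hF.continuous
  have hgradAt : ∀ p, HasGradientAt F (gradient F p) p := fun p =>
    ((hF.differentiable (by simp)) p).hasGradientAt
  have hreg : ∀ p, F p = 0 → ∃ g, g ≠ 0 ∧ HasGradientAt F g p := fun p hp =>
    ⟨gradient F p, hgrad p hp, hgradAt p⟩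
  have hlip := signedInfDist_sub_le_dist hFc
  have huniq : ∀ y, y ∉ M →
      {p | p ∈ F ⁻¹' {0} ∧ dist y p = infDist y (F ⁻¹' {0})}.Subsingleton := by
    intro y hy a ha b hb
    by_contra hab
    exact hy (hM ▸ subset_closure ⟨a, ha.1, b, hb.1, hab, ha.2, hb.2⟩)
  rw [hf] at hd
  have hL : 0 ≤ infDist q M := infDist_nonneg
  set L := infDist q M
  have hlog : 0 ≤ -Real.log (1 - ε) :=
    neg_nonneg.2 (Real.log_nonpos (by linarith) (by linarith))
  rcases hL.eq_or_lt with hL0 | hLpos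
  · have hqq : q = q' := dist_le_zero.1 (by rwa [← hL0, mul_zero] at hd)
    rw [← hqq, InnerProductGeometry.angle_self]
    · exact hlog
    · exact smul_ne_zero (inv_ne_zero (norm_ne_zero_iff.2 (hgrad q hq))) (hgrad q hq)
  have hrpos : ∀ t ∈ Icc (0 : ℝ) 1, 0 < L * (1 - ε * t) := fun t ht =>
    mul_pos hLpos (by nlinarith [ht.1, ht.2])
  have hseg : ∀ t ∈ Icc (0 : ℝ) 1, ∃ w, IsUnitSpeedSegment (signedInfDist F)
      (AffineMap.lineMap q q' t) w (L * (1 - ε * t)) := fun t ht => by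
    refine exists_isUnitSpeedSegment_signedInfDist hFc hreg ⟨q, hq⟩ (hrpos t ht)
      fun y hy => huniq y fun hyM => ?_
    have h1 : L ≤ dist q y := infDist_le_dist_of_mem hyM
    have h2 := dist_triangle_right q y (AffineMap.lineMap q q' t : EuclideanSpace ℝ (Fin 3))
    rw [dist_left_lineMap, Real.norm_of_nonneg ht.1] at h2
    have h3 := mul_le_mul_of_nonneg_left hd ht.1
    rw [mem_ball] at hy
    linarith
  choose! w hw using hseg
  have hend : ∀ t ∈ Icc (0 : ℝ) 1, ∀ p ∈ F ⁻¹' {0}, AffineMap.lineMap q q' t = p →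
      w t = ‖gradient F p‖⁻¹ • gradient F p := fun t ht p hp htp =>
    IsUnitSpeedSegment.eq_of_isUnitSlopeDirection hlip (hrpos t ht) (htp ▸ hw t ht)
      (isUnitSlopeDirection_gradient hFc hp (hgradAt p) (hgrad p hp))
  rw [← hend 0 (by simp) q hq (by simp), ← hend 1 (by simp) q' hq' (by simp)]
  refine angle_le_neg_log_of_norm_sub_le hε0.le (by linarith) (fun t ht => (hw t ht).1)
    fun s hs t ht hst => ?_
  have h1 := IsUnitSpeedSegment.mul_norm_sub_le hlip (hrpos t ht).le
    ((hw s hs).mono (by gcongr)) (hw t ht)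
  rw [dist_lineMap_lineMap, dist_comm, Real.dist_eq, abs_of_nonneg (sub_nonneg.2 hst)] at h1
  have h2 := mul_le_mul_of_nonneg_left hd (sub_nonneg.2 hst)
  have hpos : 0 < 1 - ε * t := by nlinarith [ht.1, ht.2]
  rw [div_mul_eq_mul_div, le_div_iff₀ hpos]
  refine le_of_mul_le_mul_left ?_ hLpos
  linarith
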